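/- Quasi-minimality case of the stiffening iteration. In the setting of the stiffened energy W(X,t) with values in [0,∞], let σ ∈ (0,1), let t ≥ 0 and X^k, X^{k+1} ∈ E with t·f₊(X^k) < 1 and t·f₊(X^{k+1}) < 1, and set t' := t + σ·(1 − t·f₊(X^{k+1}))/f₊(X^{k+1}). Assume: (i) W(X^{k+1},t) ≤ W(X^k,t); (ii) the quasi-minimality condition inf_{Y ∈ E} W(Y,t) > (1−σ)·W(X^k,t); and (iii) there exist t* with t ≤ t* < 1 and X* ∈ E with t*·f₊(X*) < 1. Then W(X^{k+1}, t') ≤ (1−σ)^{-2} · W(X*, t*). -/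

import Mathlib

open Finset

/-- The worst-element distortion `f₊(X) = max_i f i X`. -/
noncomputable def fplus {ι E : Type*} [Fintype ι] [Nonempty ι]
    (f : ι → E → ℝ) (X : E) : ℝ :=
  Finset.univ.sup' Finset.univ_nonempty (fun i => f i X)

/-- The stiffened energy `W(X,t)`, with values in `[0,∞]`: it is
`Σᵢ vᵢ · (fᵢ X)/(1 - t·fᵢ X)` when `t·f₊(X) < 1`, and `+∞` when
`t·f₊(X) ≥ 1`. -/
noncomputable def W {ι E : Type*} [Fintype ι] [Nonempty ι]
    (v : ι → ℝ) (f : ι → E → ℝ) (X : E) (t : ℝ) : ENNReal :=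
  if t * fplus f X < 1 then
    ENNReal.ofReal (∑ i, v i * (f i X / (1 - t * f i X)))
  else ⊤

theorem le_fplus {ι E : Type*} [Fintype ι] [Nonempty ι] (f : ι → E → ℝ) (i : ι) (X : E) :
    f i X ≤ fplus f X :=
  Finset.le_sup' (fun i => f i X) (Finset.mem_univ i)

theorem fplus_pos {ι E : Type*} [Fintype ι] [Nonempty ι] {f : ι → E → ℝ} {X : E}
    (hf : ∀ i, 0 < f i X) : 0 < fplus f X :=
  (hf (Classical.arbitrary ι)).trans_le (le_fplus f _ X)

theorem one_sub_mul_pos {ι E : Type*} [Fintype ι] [Nonempty ι] {f : ι → E → ℝ} {X : E}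
    (hf : ∀ i, 0 < f i X) {t : ℝ} (h : t * fplus f X < 1) (i : ι) :
    0 < 1 - t * f i X := by
  rcases le_total 0 t with ht | ht
  · linarith [mul_le_mul_of_nonneg_left (le_fplus f i X) ht]
  · linarith [mul_nonpos_of_nonpos_of_nonneg ht (hf i).le]

/-- The stiffened energy is monotone in the stiffening parameter. -/
theorem W_mono {ι E : Type*} [Fintype ι] [Nonempty ι] {v : ι → ℝ} (hv : ∀ i, 0 ≤ v i)
    {f : ι → E → ℝ} {X : E} (hf : ∀ i, 0 < f i X) : Monotone (W v f X) := by
  intro t s hts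
  by_cases hs : s * fplus f X < 1
  · have ht : t * fplus f X < 1 :=
      (mul_le_mul_of_nonneg_right hts (fplus_pos hf).le).trans_lt hs
    rw [W, W, if_pos ht, if_pos hs]
    refine ENNReal.ofReal_le_ofReal (Finset.sum_le_sum fun i _ => ?_)
    refine mul_le_mul_of_nonneg_left ?_ (hv i)
    refine div_le_div_of_nonneg_left (hf i).le (one_sub_mul_pos hf hs i) ?_
    linarith [mul_le_mul_of_nonneg_right hts (hf i).le]
  · simp [W, if_neg hs]

/-- Moving `t` a fraction `σ` of the way towards the barrier `1 / f₊(X)` increases the energy by a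
factor of at most `(1 - σ)⁻¹`. -/
theorem W_step_le {ι E : Type*} [Fintype ι] [Nonempty ι] {v : ι → ℝ} (hv : ∀ i, 0 ≤ v i)
    {f : ι → E → ℝ} {X : E} (hf : ∀ i, 0 < f i X) {σ : ℝ} (hσ0 : 0 ≤ σ) (hσ1 : σ < 1)
    {t : ℝ} (ht : t * fplus f X < 1) :
    W v f X (t + σ * (1 - t * fplus f X) / fplus f X) ≤
      ENNReal.ofReal (1 - σ)⁻¹ * W v f X t := by
  have hF := fplus_pos hf
  have hσ : 0 < 1 - σ := sub_pos.2 hσ1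
  have ht' : (t + σ * (1 - t * fplus f X) / fplus f X) * fplus f X < 1 := by
    rw [add_mul, div_mul_cancel₀ _ hF.ne']
    nlinarith
  rw [W, W, if_pos ht, if_pos ht', ← ENNReal.ofReal_mul (inv_pos.2 hσ).le, Finset.mul_sum]
  refine ENNReal.ofReal_le_ofReal (Finset.sum_le_sum fun i _ => ?_)
  rw [mul_left_comm]
  refine mul_le_mul_of_nonneg_left ?_ (hv i)
  have hpos := one_sub_mul_pos hf ht i
  rw [inv_mul_eq_div, div_div]
  refine div_le_div_of_nonneg_left (hf i).le (mul_pos hpos hσ) ?_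
  have hr : f i X / fplus f X ≤ 1 := (div_le_one hF).2 (le_fplus f i X)
  have hexp : (t + σ * (1 - t * fplus f X) / fplus f X) * f i X =
      t * f i X + σ * (f i X / fplus f X - t * f i X) := by
    field_simp
  rw [hexp]
  nlinarith [mul_le_mul_of_nonneg_left hr hσ0]

/-- Quasi-minimality case of the stiffening iteration: the stiffened energy
after one QIS step is bounded by `(1-σ)⁻² · W(X*, t*)`. -/
theorem qis_quasi_minimality_bound
    {ι E : Type*} [Fintype ι] [Nonempty ι]
    (v : ι → ℝ) (hv : ∀ i, 0 < v i)
    (f : ι → E → ℝ) (hf : ∀ i X, 1 ≤ f i X)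
    (σ : ℝ) (hσ : σ ∈ Set.Ioo (0:ℝ) 1)
    (t : ℝ) (ht : 0 ≤ t)
    (Xk Xk1 : E)
    (htk : t * fplus f Xk < 1) (htk1 : t * fplus f Xk1 < 1)
    (t' : ℝ) (ht' : t' = t + σ * (1 - t * fplus f Xk1) / fplus f Xk1)
    (hmono : W v f Xk1 t ≤ W v f Xk t)
    (hqm : (⨅ Y : E, W v f Y t) > ENNReal.ofReal (1 - σ) * W v f Xk t)
    (tstar : ℝ) (hts1 : t ≤ tstar) (hts2 : tstar < 1)
    (Xstar : E) (hfeas : tstar * fplus f Xstar < 1) :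
    W v f Xk1 t' ≤ ENNReal.ofReal ((1 - σ)⁻¹ ^ 2) * W v f Xstar tstar := by
  have hσ1 : 0 < 1 - σ := sub_pos.2 hσ.2
  have hfpos : ∀ X i, 0 < f i X := fun X i => one_pos.trans_le (hf i X)
  have hv0 : ∀ i, 0 ≤ v i := fun i => (hv i).le
  have hXk : W v f Xk t ≤ ENNReal.ofReal (1 - σ)⁻¹ * W v f Xstar tstar := by
    calc W v f Xk t
        = ENNReal.ofReal (1 - σ)⁻¹ * (ENNReal.ofReal (1 - σ) * W v f Xk t) := by
          rw [← mul_assoc, ← ENNReal.ofReal_mul (inv_pos.2 hσ1).le, inv_mul_cancel₀ hσ1.ne',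
            ENNReal.ofReal_one, one_mul]
      _ ≤ ENNReal.ofReal (1 - σ)⁻¹ * W v f Xstar tstar := by
          gcongr
          exact hqm.le.trans ((iInf_le _ Xstar).trans (W_mono hv0 (hfpos Xstar) hts1))
  calc W v f Xk1 t'
      ≤ ENNReal.ofReal (1 - σ)⁻¹ * W v f Xk1 t :=
        ht' ▸ W_step_le hv0 (hfpos Xk1) hσ.1.le hσ.2 htk1
    _ ≤ ENNReal.ofReal (1 - σ)⁻¹ * (ENNReal.ofReal (1 - σ)⁻¹ * W v f Xstar tstar) := by
        gcongr
        exact hmono.trans hXk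
    _ = ENNReal.ofReal ((1 - σ)⁻¹ ^ 2) * W v f Xstar tstar := by
        rw [← mul_assoc, ← ENNReal.ofReal_mul (inv_pos.2 hσ1).le, sq]
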